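/- Assume f_ρ(β) > 0. If u is a positive super-solution of equation (E) in Ω∖{0} such that for every η > 0 one has |x|^{β−η} u(x) → ∞ as |x| → 0, then liminf_{|x|→0} |x|^β u(x) ≥ Λ. -/

import Mathlib

open MeasureTheory Filter Topology Real RealInnerProductSpace

noncomputable section

/-- The gradient factor `G_τ(x,z,ξ) = z^τ ‖ξ‖^(1-τ) / ‖x‖^(τ+1)`.
For `τ = 0` this equals `‖ξ‖ / ‖x‖`, since `z ^ (0:ℝ) = 1` for real powers. -/
def Gt {N : ℕ} (τ : ℝ) (x : EuclideanSpace ℝ (Fin N)) (z : ℝ)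
    (ξ : EuclideanSpace ℝ (Fin N)) : ℝ :=
  z ^ τ * ‖ξ‖ ^ (1 - τ) / ‖x‖ ^ (τ + 1)

/-- Test functions: `C¹` functions with compact support contained in `Ω \ {0}`. -/
def IsTestFun {N : ℕ} (Ω : Set (EuclideanSpace ℝ (Fin N)))
    (φ : EuclideanSpace ℝ (Fin N) → ℝ) : Prop :=
  ContDiff ℝ 1 φ ∧ HasCompactSupport φ ∧ tsupport φ ⊆ Ω \ {0}

/-- The distributional pairing of equation (E) with a test function `φ`:
`∫ ∇u·∇φ + (N-2+2ρ) ∫ ((x·∇u)/|x|²) φ - λ ∫ G_τ(x,u,∇u) φ + ∫ |x|^θ u^q φ`. -/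
def weakE (N : ℕ) (ρ lam τ θ q : ℝ) (Ω : Set (EuclideanSpace ℝ (Fin N)))
    (u φ : EuclideanSpace ℝ (Fin N) → ℝ) : ℝ :=
  (∫ x in Ω \ {0}, ⟪gradient u x, gradient φ x⟫)
    + ((N : ℝ) - 2 + 2 * ρ) * (∫ x in Ω \ {0}, ⟪x, gradient u x⟫ / ‖x‖ ^ 2 * φ x)
    - lam * (∫ x in Ω \ {0}, Gt τ x (u x) (gradient u x) * φ x)
    + ∫ x in Ω \ {0}, ‖x‖ ^ θ * u x ^ q * φ x

/-- A positive `C¹` function on `Ω \ {0}`. -/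
def PosC1 {N : ℕ} (Ω : Set (EuclideanSpace ℝ (Fin N)))
    (u : EuclideanSpace ℝ (Fin N) → ℝ) : Prop :=
  ContDiffOn ℝ 1 u (Ω \ {0}) ∧ ∀ x ∈ Ω \ {0}, 0 < u x

/-- Positive distributional solution of equation (E) in `Ω \ {0}`. -/
def IsSolutionE (N : ℕ) (ρ lam τ θ q : ℝ) (Ω : Set (EuclideanSpace ℝ (Fin N)))
    (u : EuclideanSpace ℝ (Fin N) → ℝ) : Prop :=
  PosC1 Ω u ∧ ∀ φ, IsTestFun Ω φ → weakE N ρ lam τ θ q Ω u φ = 0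

/-- Positive sub-solution of equation (E) in `Ω \ {0}`. -/
def IsSubSolutionE (N : ℕ) (ρ lam τ θ q : ℝ) (Ω : Set (EuclideanSpace ℝ (Fin N)))
    (u : EuclideanSpace ℝ (Fin N) → ℝ) : Prop :=
  PosC1 Ω u ∧ ∀ φ, IsTestFun Ω φ → (∀ x, 0 ≤ φ x) → weakE N ρ lam τ θ q Ω u φ ≤ 0

/-- Positive super-solution of equation (E) in `Ω \ {0}`. -/
def IsSuperSolutionE (N : ℕ) (ρ lam τ θ q : ℝ) (Ω : Set (EuclideanSpace ℝ (Fin N)))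
    (u : EuclideanSpace ℝ (Fin N) → ℝ) : Prop :=
  PosC1 Ω u ∧ ∀ φ, IsTestFun Ω φ → (∀ x, 0 ≤ φ x) → 0 ≤ weakE N ρ lam τ θ q Ω u φ

/-- `f_ρ(t) = t (t + 2ρ) + λ |t|^(1-τ)`. -/
def fRho (ρ lam τ t : ℝ) : ℝ := t * (t + 2 * ρ) + lam * |t| ^ (1 - τ)

/-- `Υ = ((τ+1)/(2τ)) (λτ)^(1/(τ+1))`. -/
def Upsilon (lam τ : ℝ) : ℝ := ((τ + 1) / (2 * τ)) * (lam * τ) ^ (1 / (τ + 1))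

/-- Case [N₀]: (a) `τ = 0` and `λ ≥ 2ρ`, or (b) `λ > 0`, `τ ∈ (0,1)` and `ρ < Υ`. -/
def CaseN0 (ρ lam τ : ℝ) : Prop :=
  (τ = 0 ∧ 2 * ρ ≤ lam) ∨ (0 < lam ∧ 0 < τ ∧ τ < 1 ∧ ρ < Upsilon lam τ)

/-- Case [N₁]: (a) `τ = 0` and `λ < 2ρ`, or (b) `λ < 0` and `τ ∈ (0,1)`. -/
def CaseN1 (ρ lam τ : ℝ) : Prop :=
  (τ = 0 ∧ lam < 2 * ρ) ∨ (lam < 0 ∧ 0 < τ ∧ τ < 1)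

/-- Case [N₂]: `λ > 0`, `τ ∈ (0,1)` and `ρ ≥ Υ`. -/
def CaseN2 (ρ lam τ : ℝ) : Prop :=
  0 < lam ∧ 0 < τ ∧ τ < 1 ∧ Upsilon lam τ ≤ ρ

/-- `w` is the smallest negative root of `f_ρ` (i.e. `w = ϖ₁`). -/
def IsMinNegRoot (ρ lam τ w : ℝ) : Prop :=
  w < 0 ∧ fRho ρ lam τ w = 0 ∧ ∀ t, t < 0 → fRho ρ lam τ t = 0 → w ≤ t

/-- `w` is the largest negative root of `f_ρ` (i.e. `w = ϖ₂`). -/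
def IsMaxNegRoot (ρ lam τ w : ℝ) : Prop :=
  w < 0 ∧ fRho ρ lam τ w = 0 ∧ ∀ t, t < 0 → fRho ρ lam τ t = 0 → t ≤ w

/-- `Φ_{ϖ₂}(r)`: equal to `r^(-ϖ₂)` if `ρ > Υ` and to `r^(-ϖ₂) |log r|^(2/(1+τ))` if `ρ = Υ`. -/
def Phi2 (ρ lam τ w2 r : ℝ) : ℝ :=
  if ρ = Upsilon lam τ then r ^ (-w2) * |Real.log r| ^ (2 / (1 + τ)) else r ^ (-w2)

/-- `Ψ_{ϖ₁}(t)`: equal to `t^(-ϖ₁)` if `ρ > Υ` and to `t^(-ϖ₁) (log t)^(2/(1+τ))` if `ρ = Υ`. -/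
def Psi1 (ρ lam τ w1 t : ℝ) : ℝ :=
  if ρ = Upsilon lam τ then t ^ (-w1) * (Real.log t) ^ (2 / (1 + τ)) else t ^ (-w1)

/-- The radial operator `L_{ρ,λ,τ}[P](r) = P'' + (1-2ρ) P'/r + λ P^τ |P'|^(1-τ)/r^(1+τ)`. -/
def Lrad (ρ lam τ : ℝ) (P : ℝ → ℝ) (r : ℝ) : ℝ :=
  deriv (deriv P) r + (1 - 2 * ρ) * deriv P r / r
    + lam * P r ^ τ * |deriv P r| ^ (1 - τ) / r ^ (1 + τ)

/-- The Laplacian of `u` at `x`, as the trace of the second derivative. -/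
def lapl {N : ℕ} (u : EuclideanSpace ℝ (Fin N) → ℝ) (x : EuclideanSpace ℝ (Fin N)) : ℝ :=
  ∑ i : Fin N, iteratedFDeriv ℝ 2 u x ![EuclideanSpace.single i 1, EuclideanSpace.single i 1]
lemma tsupport_gradient_subset {N : ℕ} (φ : EuclideanSpace ℝ (Fin N) → ℝ) :
    tsupport (gradient φ) ⊆ tsupport φ := by
  refine (closure_mono fun x hx => ?_).trans (tsupport_fderiv_subset ℝ (f := φ))
  intro h
  apply hx
  simp [gradient, h]

lemma tsupport_inner_gradient_subset {N : ℕ}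
    (W : EuclideanSpace ℝ (Fin N) → EuclideanSpace ℝ (Fin N))
    (φ : EuclideanSpace ℝ (Fin N) → ℝ) :
    tsupport (fun x => ⟪W x, gradient φ x⟫) ⊆ tsupport φ := by
  refine (closure_mono fun x hx => ?_).trans (tsupport_gradient_subset φ)
  intro h
  apply hx
  simp [h]

lemma ContDiffOn.continuousOn_gradient {N : ℕ} {U : Set (EuclideanSpace ℝ (Fin N))}
    {u : EuclideanSpace ℝ (Fin N) → ℝ} (hU : IsOpen U) (hu : ContDiffOn ℝ 1 u U) :
    ContinuousOn (gradient u) U :=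
  (InnerProductSpace.toDual ℝ (EuclideanSpace ℝ (Fin N))).symm.continuous.comp_continuousOn
    (hu.continuousOn_fderiv_of_isOpen hU le_rfl)

/-- The divergence of a vector field. -/
def divergence {N : ℕ} (V : EuclideanSpace ℝ (Fin N) → EuclideanSpace ℝ (Fin N))
    (x : EuclideanSpace ℝ (Fin N)) : ℝ :=
  ∑ i : Fin N, fderiv ℝ (fun y => V y i) x (EuclideanSpace.single i 1)

lemma ContDiffOn.continuousOn_divergence {N : ℕ} {U : Set (EuclideanSpace ℝ (Fin N))}
    {V : EuclideanSpace ℝ (Fin N) → EuclideanSpace ℝ (Fin N)} (hU : IsOpen U)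
    (hV : ContDiffOn ℝ 1 V U) : ContinuousOn (divergence V) U := by
  unfold divergence
  refine continuousOn_finsetSum _ fun i _ => ?_
  have h : ContDiffOn ℝ 1 (fun y => V y i) U := contDiffOn_euclidean.1 hV i
  exact (h.continuousOn_fderiv_of_isOpen hU le_rfl).clm_apply continuousOn_const

/-- Integration by parts against the gradient of a compactly supported function. -/
lemma integral_inner_gradient_eq_neg_divergence {N : ℕ} {U : Set (EuclideanSpace ℝ (Fin N))}
    {V : EuclideanSpace ℝ (Fin N) → EuclideanSpace ℝ (Fin N)} {φ : EuclideanSpace ℝ (Fin N) → ℝ}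
    (hU : IsOpen U) (hV : ContDiffOn ℝ 1 V U) (hφ : ContDiff ℝ 1 φ) (hc : HasCompactSupport φ)
    (hs : tsupport φ ⊆ U) :
    ∫ x, ⟪V x, gradient φ x⟫ = -∫ x, divergence V x * φ x := by
  have hVi : ∀ i, ContDiffOn ℝ 1 (fun y => V y i) U := contDiffOn_euclidean.1 hV
  have hint : ∀ f : EuclideanSpace ℝ (Fin N) → ℝ, ContinuousOn f U → tsupport f ⊆ tsupport φ →
      Integrable f := fun f hf hfs =>
    (hf.continuous_of_tsupport_subset hU (hfs.trans hs)).integrable_of_hasCompactSupport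
      (hc.of_isClosed_subset (isClosed_tsupport f) hfs)
  have h1 : ∀ i : Fin N, Integrable fun x =>
      fderiv ℝ (fun y => V y i) x (EuclideanSpace.single i 1) * φ x := fun i =>
    hint _ ((((hVi i).continuousOn_fderiv_of_isOpen hU le_rfl).clm_apply continuousOn_const).mul
      hφ.continuous.continuousOn) (tsupport_mul_subset_right)
  have h2 : ∀ i : Fin N, Integrable fun x =>
      V x i * fderiv ℝ φ x (EuclideanSpace.single i 1) := fun i =>
    hint _ ((hVi i).continuousOn.mul
      ((hφ.continuous_fderiv one_ne_zero).clm_apply continuous_const).continuousOn)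
      (tsupport_mul_subset_right.trans (tsupport_fderiv_apply_subset ℝ _))
  have h3 : ∀ i : Fin N, Integrable fun x => V x i * φ x := fun i =>
    hint _ ((hVi i).continuousOn.mul hφ.continuous.continuousOn) tsupport_mul_subset_right
  have hL : ∀ x, ⟪V x, gradient φ x⟫ =
      ∑ i : Fin N, V x i * fderiv ℝ φ x (EuclideanSpace.single i 1) := by
    intro x
    rw [inner_gradient_right]
    conv_lhs => rw [← (EuclideanSpace.basisFun (Fin N) ℝ).sum_repr (V x)]
    simp [map_sum]
  simp_rw [hL, divergence, Finset.sum_mul]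
  rw [integral_finsetSum _ fun i _ => h2 i, integral_finsetSum _ fun i _ => h1 i,
    ← Finset.sum_neg_distrib]
  refine Finset.sum_congr rfl fun i _ => ?_
  refine integral_mul_fderiv_eq_neg_fderiv_mul_of_integrable (h1 i) (h2 i) (h3 i) ?_ ?_
  · intro x hx
    exact ((hVi i).differentiableOn one_ne_zero).differentiableAt (hU.mem_nhds (hs hx))
  · intro x _
    exact hφ.differentiable one_ne_zero x

/-- The integrand of `weakE` without the principal part and the test function. -/
def lowerOrder (N : ℕ) (ρ lam τ θ q : ℝ) (u : EuclideanSpace ℝ (Fin N) → ℝ)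
    (x : EuclideanSpace ℝ (Fin N)) : ℝ :=
  ((N : ℝ) - 2 + 2 * ρ) * (⟪x, gradient u x⟫ / ‖x‖ ^ 2) - lam * Gt τ x (u x) (gradient u x)
    + ‖x‖ ^ θ * u x ^ q

lemma PosC1.continuousOn_inner_gradient_div {N : ℕ} {Ω : Set (EuclideanSpace ℝ (Fin N))}
    {u : EuclideanSpace ℝ (Fin N) → ℝ} (hΩ : IsOpen (Ω \ {0})) (hu : PosC1 Ω u) :
    ContinuousOn (fun x => ⟪x, gradient u x⟫ / ‖x‖ ^ 2) (Ω \ {0}) :=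
  (continuousOn_id.inner (hu.1.continuousOn_gradient hΩ)).div (by fun_prop)
    fun x hx => pow_ne_zero 2 (norm_ne_zero_iff.2 hx.2)

lemma PosC1.continuousOn_Gt {N : ℕ} {τ : ℝ} {Ω : Set (EuclideanSpace ℝ (Fin N))}
    {u : EuclideanSpace ℝ (Fin N) → ℝ} (hΩ : IsOpen (Ω \ {0})) (hτ1 : τ < 1) (hu : PosC1 Ω u) :
    ContinuousOn (fun x => Gt τ x (u x) (gradient u x)) (Ω \ {0}) := by
  unfold Gt
  refine ((hu.1.continuousOn.rpow_const fun x hx => Or.inl (hu.2 x hx).ne').mul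
    ((hu.1.continuousOn_gradient hΩ).norm.rpow_const fun x _ => Or.inr (by linarith))).div
    (continuousOn_id.norm.rpow_const fun x hx => Or.inl (norm_ne_zero_iff.2 hx.2)) fun x hx => ?_
  exact (Real.rpow_pos_of_pos (norm_pos_iff.2 hx.2) _).ne'

lemma PosC1.continuousOn_rpow_mul_rpow {N : ℕ} {θ q : ℝ} {Ω : Set (EuclideanSpace ℝ (Fin N))}
    {u : EuclideanSpace ℝ (Fin N) → ℝ} (hu : PosC1 Ω u) :
    ContinuousOn (fun x => ‖x‖ ^ θ * u x ^ q) (Ω \ {0}) :=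
  (continuousOn_id.norm.rpow_const fun _ hx => Or.inl (norm_ne_zero_iff.2 hx.2)).mul
    (hu.1.continuousOn.rpow_const fun x hx => Or.inl (hu.2 x hx).ne')

lemma PosC1.continuousOn_lowerOrder {N : ℕ} {ρ lam τ θ q : ℝ} {Ω : Set (EuclideanSpace ℝ (Fin N))}
    {u : EuclideanSpace ℝ (Fin N) → ℝ} (hΩ : IsOpen (Ω \ {0})) (hτ1 : τ < 1) (hu : PosC1 Ω u) :
    ContinuousOn (lowerOrder N ρ lam τ θ q u) (Ω \ {0}) :=
  ((continuousOn_const.mul (hu.continuousOn_inner_gradient_div hΩ)).sub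
    (continuousOn_const.mul (hu.continuousOn_Gt hΩ hτ1))).add hu.continuousOn_rpow_mul_rpow

/-- Subtracting a `C¹` vector field `V` from the gradient in the weak formulation. -/
lemma weakE_eq_integral {N : ℕ} {ρ lam τ θ q : ℝ} {Ω : Set (EuclideanSpace ℝ (Fin N))}
    {u φ : EuclideanSpace ℝ (Fin N) → ℝ}
    {V : EuclideanSpace ℝ (Fin N) → EuclideanSpace ℝ (Fin N)}
    (hΩ : IsOpen (Ω \ {0})) (hτ1 : τ < 1) (hu : PosC1 Ω u) (hφ : IsTestFun Ω φ)
    (hV : ContDiffOn ℝ 1 V (Ω \ {0})) :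
    Integrable (fun x => ⟪gradient u x - V x, gradient φ x⟫
        + (lowerOrder N ρ lam τ θ q u x - divergence V x) * φ x) ∧
    Continuous (fun x => ⟪gradient u x - V x, gradient φ x⟫
        + (lowerOrder N ρ lam τ θ q u x - divergence V x) * φ x) ∧
    weakE N ρ lam τ θ q Ω u φ = ∫ x, (⟪gradient u x - V x, gradient φ x⟫
        + (lowerOrder N ρ lam τ θ q u x - divergence V x) * φ x) := by
  obtain ⟨hφ1, hc, hs⟩ := hφ
  have hcont : ∀ f : EuclideanSpace ℝ (Fin N) → ℝ, ContinuousOn f (Ω \ {0}) →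
      tsupport f ⊆ tsupport φ → Continuous f := fun f hf hfs =>
    hf.continuous_of_tsupport_subset hΩ (hfs.trans hs)
  have hint : ∀ f : EuclideanSpace ℝ (Fin N) → ℝ, ContinuousOn f (Ω \ {0}) →
      tsupport f ⊆ tsupport φ → Integrable f := fun f hf hfs =>
    (hcont f hf hfs).integrable_of_hasCompactSupport
      (hc.of_isClosed_subset (isClosed_tsupport f) hfs)
  have hset : ∀ f : EuclideanSpace ℝ (Fin N) → ℝ, tsupport f ⊆ tsupport φ →
      ∫ x in Ω \ {0}, f x = ∫ x, f x := fun f hfs =>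
    setIntegral_eq_integral_of_forall_compl_eq_zero fun x hx =>
      image_eq_zero_of_notMem_tsupport fun h => hx (hs (hfs h))
  have hgφ : Continuous (gradient φ) :=
    continuousOn_univ.1 (hφ1.contDiffOn.continuousOn_gradient isOpen_univ)
  have hgu := hu.1.continuousOn_gradient hΩ
  have hmul : ∀ h : EuclideanSpace ℝ (Fin N) → ℝ, ContinuousOn h (Ω \ {0}) →
      ContinuousOn (fun x => h x * φ x) (Ω \ {0}) := fun h hh =>
    hh.mul hφ1.continuous.continuousOn
  have hsup : ∀ h : EuclideanSpace ℝ (Fin N) → ℝ,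
      tsupport (fun x => h x * φ x) ⊆ tsupport φ := fun h => tsupport_mul_subset_right
  have hin : ∀ W : EuclideanSpace ℝ (Fin N) → EuclideanSpace ℝ (Fin N),
      ContinuousOn W (Ω \ {0}) → ContinuousOn (fun x => ⟪W x, gradient φ x⟫) (Ω \ {0}) :=
    fun W hW => hW.inner hgφ.continuousOn
  have hlow : ContinuousOn (fun x => lowerOrder N ρ lam τ θ q u x - divergence V x) (Ω \ {0}) :=
    (hu.continuousOn_lowerOrder hΩ hτ1).sub (hV.continuousOn_divergence hΩ)
  have hA := hin (fun x => gradient u x - V x) (hgu.sub hV.continuousOn)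
  have iA := hint _ hA (tsupport_inner_gradient_subset _ φ)
  have iu := hint _ (hin _ hgu) (tsupport_inner_gradient_subset _ φ)
  have iV := hint _ (hin _ hV.continuousOn) (tsupport_inner_gradient_subset _ φ)
  have i1 := hint _ (hmul _ (hu.continuousOn_inner_gradient_div hΩ)) (hsup _)
  have i2 := hint _ (hmul _ (hu.continuousOn_Gt hΩ hτ1)) (hsup _)
  have i3 := hint _ (hmul _ (hu.continuousOn_rpow_mul_rpow (θ := θ) (q := q))) (hsup _)
  have i4 := hint _ (hmul _ (hV.continuousOn_divergence hΩ)) (hsup _)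
  have iB := hint _ (hmul _ hlow) (hsup _)
  refine ⟨iA.add iB, (hcont _ hA (tsupport_inner_gradient_subset _ φ)).add
    (hcont _ (hmul _ hlow) (hsup _)), ?_⟩
  have hV0 := integral_inner_gradient_eq_neg_divergence hΩ hV hφ1 hc hs
  have hsplit : ∫ x, (⟪gradient u x - V x, gradient φ x⟫
        + (lowerOrder N ρ lam τ θ q u x - divergence V x) * φ x) =
      (∫ x, ⟪gradient u x, gradient φ x⟫) - (∫ x, ⟪V x, gradient φ x⟫)
      + (((N : ℝ) - 2 + 2 * ρ) * (∫ x, ⟪x, gradient u x⟫ / ‖x‖ ^ 2 * φ x)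
      - lam * (∫ x, Gt τ x (u x) (gradient u x) * φ x)
      + (∫ x, ‖x‖ ^ θ * u x ^ q * φ x) - ∫ x, divergence V x * φ x) := by
    have j12 := (i1.const_mul ((N : ℝ) - 2 + 2 * ρ)).sub (i2.const_mul lam)
    rw [integral_add iA iB, ← integral_sub iu iV, ← integral_const_mul, ← integral_const_mul,
      ← integral_sub (i1.const_mul _) (i2.const_mul _)]
    erw [← integral_add j12 i3, ← integral_sub (j12.add i3) i4]
    congr 1
    · simp_rw [inner_sub_left]
    · congr 1
      ext x
      simp only [lowerOrder, Pi.add_apply, Pi.sub_apply]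
      ring
  rw [hsplit, hV0, weakE, hset _ (tsupport_inner_gradient_subset _ φ), hset _ (hsup _),
    hset _ (hsup _), hset _ (hsup _)]
  ring

/-- A weak super-solution satisfies the equation in the viscosity sense: if `Q` touches `u`
strictly from below at `x₀`, then `Q` satisfies the super-solution inequality at `x₀`. -/
lemma IsSuperSolutionE.divergence_le_of_touching {N : ℕ} {ρ lam τ θ q : ℝ}
    {Ω : Set (EuclideanSpace ℝ (Fin N))} {u Q : EuclideanSpace ℝ (Fin N) → ℝ}
    {V : EuclideanSpace ℝ (Fin N) → EuclideanSpace ℝ (Fin N)} {x₀ : EuclideanSpace ℝ (Fin N)}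
    {ε : ℝ} (hΩ : IsOpen (Ω \ {0})) (hτ1 : τ < 1) (hu : IsSuperSolutionE N ρ lam τ θ q Ω u)
    (hx₀ : x₀ ∈ Ω \ {0}) (hε : 0 < ε) (hQV : ∀ x ∈ Ω \ {0}, HasGradientAt Q (V x) x)
    (hV : ContDiffOn ℝ 1 V (Ω \ {0})) (heq : u x₀ = Q x₀)
    (hle : ∀ᶠ x in 𝓝 x₀, Q x + ε * ‖x - x₀‖ ^ 2 ≤ u x) :
    gradient u x₀ = V x₀ ∧ divergence V x₀ ≤ lowerOrder N ρ lam τ θ q u x₀ := by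
  obtain ⟨hu1, hu2⟩ := hu
  have hugrad : ∀ x ∈ Ω \ {0}, HasGradientAt u (gradient u x) x := fun x hx =>
    ((hu1.1.differentiableOn one_ne_zero).differentiableAt (hΩ.mem_nhds hx)).hasGradientAt
  have hgrad : gradient u x₀ = V x₀ := by
    have hmin : IsLocalMin (fun x => u x - Q x) x₀ := by
      filter_upwards [hle] with x hx
      have : 0 ≤ ε * ‖x - x₀‖ ^ 2 := by positivity
      linarith
    have h := hmin.hasFDerivAt_eq_zero
      ((hugrad x₀ hx₀).hasFDerivAt.sub (hQV x₀ hx₀).hasFDerivAt)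
    exact (InnerProductSpace.toDual ℝ (EuclideanSpace ℝ (Fin N))).injective (sub_eq_zero.1 h)
  refine ⟨hgrad, ?_⟩
  by_contra! hlt
  have hcontH : ContinuousOn (fun x => divergence V x - lowerOrder N ρ lam τ θ q u x) (Ω \ {0}) :=
    (hV.continuousOn_divergence hΩ).sub (hu1.continuousOn_lowerOrder hΩ hτ1)
  have hHpos : ∀ᶠ x in 𝓝 x₀, 0 < divergence V x - lowerOrder N ρ lam τ θ q u x :=
    (hcontH.continuousAt (hΩ.mem_nhds hx₀)).eventually (lt_mem_nhds (sub_pos.2 hlt))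
  obtain ⟨r, hr, hball⟩ := Metric.eventually_nhds_iff_ball.1
    ((hle.and hHpos).and (hΩ.mem_nhds hx₀))
  set m := ε * (r / 2) ^ 2 with hm
  have hmpos : 0 < m := by positivity
  set ψ := Real.smoothTransition
  have hψ : ContDiff ℝ 1 ψ := Real.smoothTransition.contDiff
  classical
  set φ : EuclideanSpace ℝ (Fin N) → ℝ := fun x =>
    if x ∈ Metric.ball x₀ r then ψ (m - (u x - Q x)) else 0 with hφdef
  have hφzero : ∀ x, x ∉ Metric.closedBall x₀ (r / 2) → φ x = 0 := by
    intro x hx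
    simp only [hφdef]
    split_ifs with hxb
    · apply Real.smoothTransition.zero_of_nonpos
      have h1 := (hball x hxb).1.1
      rw [Metric.mem_closedBall, dist_eq_norm, not_le] at hx
      have : (r / 2) ^ 2 ≤ ‖x - x₀‖ ^ 2 := by gcongr
      have : m ≤ ε * ‖x - x₀‖ ^ 2 := by rw [hm]; gcongr
      linarith
    · rfl
  have hts : tsupport φ ⊆ Metric.closedBall x₀ (r / 2) :=
    closure_minimal (fun x hx => by_contra fun h => hx (hφzero x h)) Metric.isClosed_closedBall
  have hcb : Metric.closedBall x₀ (r / 2) ⊆ Metric.ball x₀ r :=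
    Metric.closedBall_subset_ball (by linarith)
  have hφeq : ∀ x ∈ Metric.ball x₀ r, φ =ᶠ[𝓝 x] fun x => ψ (m - (u x - Q x)) := by
    intro x hx
    filter_upwards [Metric.isOpen_ball.mem_nhds hx] with y hy
    exact if_pos hy
  have hQC : ContDiffOn ℝ 1 Q (Ω \ {0}) := by
    rw [show (1 : WithTop ℕ∞) = 0 + 1 from rfl, contDiffOn_succ_iff_fderiv_of_isOpen hΩ]
    refine ⟨fun x hx => (hQV x hx).differentiableAt.differentiableWithinAt, by simp, ?_⟩
    rw [contDiffOn_zero]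
    refine ContinuousOn.congr ((InnerProductSpace.toDual ℝ
      (EuclideanSpace ℝ (Fin N))).continuous.comp_continuousOn hV.continuousOn) fun x hx => ?_
    exact (hQV x hx).hasFDerivAt.fderiv
  have hφC : ContDiff ℝ 1 φ := by
    rw [contDiff_iff_contDiffAt]
    intro x
    by_cases hx : x ∈ Metric.ball x₀ r
    · refine ContDiffAt.congr_of_eventuallyEq ?_ (hφeq x hx)
      have hxΩ := hΩ.mem_nhds (hball x hx).2
      exact hψ.contDiffAt.comp x
        (contDiffAt_const.sub ((hu1.1.contDiffAt hxΩ).sub (hQC.contDiffAt hxΩ)))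
    · have : φ =ᶠ[𝓝 x] fun _ => 0 := by
        filter_upwards [Metric.isClosed_closedBall.isOpen_compl.mem_nhds
          (fun h => hx (hcb h) : x ∈ (Metric.closedBall x₀ (r / 2))ᶜ)] with y hy
        exact hφzero y hy
      exact contDiffAt_const.congr_of_eventuallyEq this
  have htest : IsTestFun Ω φ :=
    ⟨hφC, (isCompact_closedBall x₀ (r / 2)).of_isClosed_subset (isClosed_tsupport φ) hts,
      fun x hx => (hball x (hcb (hts hx))).2⟩
  have hφnonneg : ∀ x, 0 ≤ φ x := by
    intro x
    simp only [hφdef]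
    split_ifs
    · exact Real.smoothTransition.nonneg _
    · exact le_rfl
  have hφgrad : ∀ x ∈ Metric.ball x₀ r,
      gradient φ x = -(deriv ψ (m - (u x - Q x)) • (gradient u x - V x)) := by
    intro x hx
    have hxΩ := (hball x hx).2
    have h1 : HasFDerivAt (fun x => m - (u x - Q x))
        (-(InnerProductSpace.toDual ℝ _ (gradient u x) - InnerProductSpace.toDual ℝ _ (V x))) x :=
      ((hugrad x hxΩ).hasFDerivAt.sub (hQV x hxΩ).hasFDerivAt).const_sub m
    have h2 := ((hψ.differentiable one_ne_zero (m - (u x - Q x))).hasDerivAt).comp_hasFDerivAt x h1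
    have h3 := (h2.congr_of_eventuallyEq (hφeq x hx)).fderiv
    rw [← map_sub, ← map_neg, ← map_smul] at h3
    rw [gradient, h3, LinearIsometryEquiv.symm_apply_apply, smul_neg]
  obtain ⟨hi, hcont, hweak⟩ := weakE_eq_integral (ρ := ρ) (lam := lam) (θ := θ) (q := q)
    hΩ hτ1 hu1 htest hV
  have hneg : 0 < ∫ x, -(⟪gradient u x - V x, gradient φ x⟫
        + (lowerOrder N ρ lam τ θ q u x - divergence V x) * φ x) := by
    refine integral_pos_of_integrable_nonneg_nonzero (x := x₀) hcont.neg hi.neg ?_ ?_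
    · intro x
      simp only [Pi.zero_apply]
      by_cases hx : x ∈ Metric.ball x₀ r
      · rw [hφgrad x hx, inner_neg_right, inner_smul_right, real_inner_self_eq_norm_sq]
        have h1 : 0 ≤ deriv ψ (m - (u x - Q x)) * ‖gradient u x - V x‖ ^ 2 :=
          mul_nonneg Real.smoothTransition.monotone.deriv_nonneg (by positivity)
        have h2 := mul_nonneg (hball x hx).1.2.le (hφnonneg x)
        linarith
      · have hx' : x ∉ tsupport φ := fun h => hx (hcb (hts h))
        have hg : gradient φ x = 0 :=
          image_eq_zero_of_notMem_tsupport fun h => hx' (tsupport_gradient_subset φ h)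
        rw [hg, image_eq_zero_of_notMem_tsupport hx']
        simp
    · have hpos : 0 < φ x₀ := by
        simp only [hφdef, Metric.mem_ball_self hr, if_true, heq, sub_self, sub_zero]
        exact Real.smoothTransition.pos_of_pos hmpos
      rw [hgrad, sub_self, inner_zero_left, zero_add, ← neg_mul, neg_sub]
      exact (mul_pos (sub_pos.2 hlt) hpos).ne'
  rw [integral_neg, ← hweak] at hneg
  have := hu2 φ htest hφnonneg
  linarith

lemma hasGradientAt_log_norm {N : ℕ} {x : EuclideanSpace ℝ (Fin N)} (hx : x ≠ 0) :
    HasGradientAt (fun y : EuclideanSpace ℝ (Fin N) => Real.log ‖y‖) ((‖x‖ ^ 2)⁻¹ • x) x := by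
  have hn : ‖x‖ ^ 2 ≠ 0 := pow_ne_zero 2 (norm_ne_zero_iff.2 hx)
  have h := (((hasStrictFDerivAt_norm_sq x).hasFDerivAt).log hn).const_mul (1 / 2 : ℝ)
  have hfun : (fun y : EuclideanSpace ℝ (Fin N) => (1 / 2 : ℝ) * Real.log (‖y‖ ^ 2)) =
      fun y => Real.log ‖y‖ := by
    ext y
    rw [Real.log_pow]
    push_cast
    ring
  rw [hfun] at h
  rw [hasGradientAt_iff_hasFDerivAt]
  refine h.congr_fderiv (ContinuousLinearMap.ext fun y => ?_)
  simp
  ring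

/-- Chain rule for the gradient of a function composed with a real function. -/
lemma HasDerivAt.comp_hasGradientAt {N : ℕ} {g : ℝ → ℝ} {g' : ℝ}
    {f : EuclideanSpace ℝ (Fin N) → ℝ} {f' x : EuclideanSpace ℝ (Fin N)}
    (hg : HasDerivAt g g' (f x)) (hf : HasGradientAt f f' x) :
    HasGradientAt (fun y => g (f y)) (g' • f') x := by
  rw [hasGradientAt_iff_hasFDerivAt, map_smul]
  exact hg.comp_hasFDerivAt x hf.hasFDerivAt

lemma divergence_smul_self_sub {N : ℕ} {k : EuclideanSpace ℝ (Fin N) → ℝ} {c ε : ℝ}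
    {x₀ x : EuclideanSpace ℝ (Fin N)} (hk : HasGradientAt k (c • x) x) :
    divergence (fun y => k y • y - (2 * ε) • (y - x₀)) x = c * ‖x‖ ^ 2 + N * (k x - 2 * ε) := by
  have hproj : ∀ i : Fin N, HasFDerivAt (fun y : EuclideanSpace ℝ (Fin N) => y i)
      (EuclideanSpace.proj i : EuclideanSpace ℝ (Fin N) →L[ℝ] ℝ) x := fun i =>
    (EuclideanSpace.proj i : EuclideanSpace ℝ (Fin N) →L[ℝ] ℝ).hasFDerivAt
  have h : ∀ i : Fin N, fderiv ℝ (fun y => (k y • y - (2 * ε) • (y - x₀)) i) x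
      (EuclideanSpace.single i 1) = c * x i ^ 2 + (k x - 2 * ε) := by
    intro i
    have hd := (hk.hasFDerivAt.mul (hproj i)).sub (((hproj i).sub_const (x₀ i)).const_mul (2 * ε))
    have hfun : (fun y : EuclideanSpace ℝ (Fin N) => (k y • y - (2 * ε) • (y - x₀)) i) =
        (k * fun y => y i) - fun y => 2 * ε * (y i - x₀ i) := by
      ext y
      simp
    rw [hfun, hd.fderiv]
    simp [EuclideanSpace.inner_single_right]
    ring
  unfold divergence
  simp_rw [h]
  rw [Finset.sum_add_distrib, ← Finset.mul_sum, ← EuclideanSpace.real_norm_sq_eq]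
  simp [mul_sub]

/-- Radial functions `exp (Z (log |x|))` touching a super-solution from below satisfy an
ordinary differential inequality at the contact point. -/
lemma IsSuperSolutionE.radial_inequality_of_touching {N : ℕ} {ρ lam τ θ q : ℝ}
    {Ω : Set (EuclideanSpace ℝ (Fin N))} {u : EuclideanSpace ℝ (Fin N) → ℝ}
    {Z Z1 Z2 : ℝ → ℝ} {x₀ : EuclideanSpace ℝ (Fin N)} (hΩ : IsOpen (Ω \ {0})) (hN : 0 < N)
    (hτ1 : τ < 1) (hu : IsSuperSolutionE N ρ lam τ θ q Ω u) (hx₀ : x₀ ∈ Ω \ {0})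
    (hZ : ∀ t, HasDerivAt Z (Z1 t) t) (hZ1 : ∀ t, HasDerivAt Z1 (Z2 t) t) (hZ2 : Continuous Z2)
    (heq : u x₀ = Real.exp (Z (Real.log ‖x₀‖)))
    (hle : ∀ᶠ x in 𝓝 x₀, Real.exp (Z (Real.log ‖x‖)) ≤ u x) :
    fRho ρ lam τ (-Z1 (Real.log ‖x₀‖)) + Z2 (Real.log ‖x₀‖) ≤
      ‖x₀‖ ^ (θ + 2) * u x₀ ^ (q - 1) := by
  set k : EuclideanSpace ℝ (Fin N) → ℝ := fun x =>
    Real.exp (Z (Real.log ‖x‖) - 2 * Real.log ‖x‖) * Z1 (Real.log ‖x‖) with hk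
  have hnz : ∀ x ∈ Ω \ {0}, x ≠ 0 := fun x hx => hx.2
  have hexp : ∀ x ∈ Ω \ {0}, Real.exp (Z (Real.log ‖x‖) - 2 * Real.log ‖x‖) =
      Real.exp (Z (Real.log ‖x‖)) * (‖x‖ ^ 2)⁻¹ := by
    intro x hx
    have hp : 0 < ‖x‖ := norm_pos_iff.2 (hnz x hx)
    rw [Real.exp_sub, two_mul, Real.exp_add, Real.exp_log hp, div_eq_mul_inv, pow_two]
  have hgradP : ∀ x ∈ Ω \ {0},
      HasGradientAt (fun y => Real.exp (Z (Real.log ‖y‖))) (k x • x) x := by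
    intro x hx
    have h := ((hZ (Real.log ‖x‖)).exp).comp_hasGradientAt (hasGradientAt_log_norm (hnz x hx))
    convert h using 1
    rw [smul_smul]
    congr 1
    simp only [hk]
    rw [hexp x hx]
    ring
  set c := (Real.exp (Z (Real.log ‖x₀‖) - 2 * Real.log ‖x₀‖) *
      ((Z1 (Real.log ‖x₀‖) - 2) * Z1 (Real.log ‖x₀‖) + Z2 (Real.log ‖x₀‖))) * (‖x₀‖ ^ 2)⁻¹ with hc
  have hgradk : HasGradientAt k (c • x₀) x₀ := by
    have hd : HasDerivAt (fun t => Real.exp (Z t - 2 * t) * Z1 t)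
        (Real.exp (Z (Real.log ‖x₀‖) - 2 * Real.log ‖x₀‖) *
          ((Z1 (Real.log ‖x₀‖) - 2) * Z1 (Real.log ‖x₀‖) + Z2 (Real.log ‖x₀‖)))
        (Real.log ‖x₀‖) := by
      have h := (((hZ (Real.log ‖x₀‖)).sub ((hasDerivAt_id _).const_mul 2)).exp).mul
        (hZ1 (Real.log ‖x₀‖))
      refine h.congr_deriv ?_
      simp only [Pi.sub_apply, id]
      ring
    have h := hd.comp_hasGradientAt (hasGradientAt_log_norm (hnz x₀ hx₀))
    rwa [smul_smul] at h
  have hZ1C : ContDiff ℝ 1 Z1 := by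
    rw [contDiff_one_iff_deriv]
    exact ⟨fun t => (hZ1 t).differentiableAt,
      by rwa [show deriv Z1 = Z2 from funext fun t => (hZ1 t).deriv]⟩
  have hZC : ContDiff ℝ 1 Z := by
    rw [contDiff_one_iff_deriv]
    exact ⟨fun t => (hZ t).differentiableAt, by
      rw [show deriv Z = Z1 from funext fun t => (hZ t).deriv]; exact hZ1C.continuous⟩
  have hlogC : ContDiffOn ℝ 1 (fun x : EuclideanSpace ℝ (Fin N) => Real.log ‖x‖) (Ω \ {0}) :=
    fun x hx => ((contDiffAt_norm ℝ (hnz x hx)).log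
      (norm_ne_zero_iff.2 (hnz x hx))).contDiffWithinAt
  have hkC : ContDiffOn ℝ 1 k (Ω \ {0}) :=
    (((hZC.comp_contDiffOn hlogC).sub (contDiffOn_const.mul hlogC)).exp).mul
      (hZ1C.comp_contDiffOn hlogC)
  have htouch : ∀ ε : ℝ, 0 < ε → gradient u x₀ = k x₀ • x₀ ∧
      c * ‖x₀‖ ^ 2 + N * (k x₀ - 2 * ε) ≤ lowerOrder N ρ lam τ θ q u x₀ := by
    intro ε hε
    have h := hu.divergence_le_of_touching (x₀ := x₀) (ε := ε)
      (Q := fun x => Real.exp (Z (Real.log ‖x‖)) - ε * ‖x - x₀‖ ^ 2)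
      (V := fun y => k y • y - (2 * ε) • (y - x₀)) hΩ hτ1 hx₀ hε ?_ ?_ ?_ ?_
    · rw [divergence_smul_self_sub hgradk] at h
      simpa using h
    · intro x hx
      rw [hasGradientAt_iff_hasFDerivAt, map_sub]
      refine (hgradP x hx).hasFDerivAt.sub ?_
      have h1 := (((hasFDerivAt_id x).sub_const x₀).norm_sq).const_mul ε
      refine h1.congr_fderiv (ContinuousLinearMap.ext fun y => ?_)
      simp
      ring
    · exact (hkC.smul contDiffOn_id).sub
        (ContDiff.contDiffOn (by fun_prop : ContDiff ℝ 1 fun y => (2 * ε) • (y - x₀)))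
    · simp [heq]
    · filter_upwards [hle] with x hx
      linarith
  have hgrad := (htouch 1 one_pos).1
  have hlim : c * ‖x₀‖ ^ 2 + N * k x₀ ≤ lowerOrder N ρ lam τ θ q u x₀ := by
    refine le_of_forall_pos_le_add fun δ hδ => ?_
    have hN' : (0 : ℝ) < N := Nat.cast_pos.2 hN
    have h := (htouch (δ / (2 * N)) (by positivity)).2
    have : (N : ℝ) * (2 * (δ / (2 * N))) = δ := by field_simp
    linarith
  have hs : 0 < ‖x₀‖ := norm_pos_iff.2 (hnz x₀ hx₀)
  have hupos : 0 < u x₀ := hu.1.2 x₀ hx₀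
  set s := ‖x₀‖ with hsdef
  set z := Z1 (Real.log s) with hz
  set U := u x₀ with hU
  have hkval : k x₀ = U * z / s ^ 2 := by
    simp only [hk]
    rw [hexp x₀ hx₀, ← heq]
    ring
  have hcval : c = U * ((z - 2) * z + Z2 (Real.log s)) / s ^ 2 / s ^ 2 := by
    rw [hc, hexp x₀ hx₀, ← heq]
    ring
  have hG : Gt τ x₀ U (gradient u x₀) = U * |z| ^ (1 - τ) / s ^ 2 := by
    have h1 : ‖gradient u x₀‖ = U * |z| / s := by
      rw [hgrad, norm_smul, hkval, Real.norm_eq_abs, abs_div, abs_mul, abs_of_pos hupos,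
        abs_of_pos (pow_pos hs 2), ← hsdef]
      field_simp
    have h2 : U ^ τ * U ^ (1 - τ) = U := by
      rw [← Real.rpow_add hupos]; simp
    have h3 : s ^ (1 - τ) * s ^ (τ + 1) = s ^ 2 := by
      rw [← Real.rpow_add hs, ← Real.rpow_natCast]
      congr 1
      push_cast
      ring
    rw [Gt, h1, Real.div_rpow (by positivity) hs.le, Real.mul_rpow hupos.le (abs_nonneg z),
      ← hsdef, ← h3]
    conv_rhs => rw [← h2]
    field_simp
  have hI : ⟪x₀, gradient u x₀⟫ / ‖x₀‖ ^ 2 = U * z / s ^ 2 := by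
    rw [hgrad, inner_smul_right, real_inner_self_eq_norm_sq, hkval, ← hsdef]
    field_simp
  have hP : s ^ θ * U ^ q = U / s ^ 2 * (s ^ (θ + 2) * U ^ (q - 1)) := by
    rw [Real.rpow_add hs, Real.rpow_sub hupos, Real.rpow_one,
      show (2 : ℝ) = ((2 : ℕ) : ℝ) by norm_num, Real.rpow_natCast]
    field_simp
  rw [lowerOrder, hI, ← hU, hG, ← hsdef, hP, hkval, hcval] at hlim
  have hfac : 0 < U / s ^ 2 := by positivity
  refine le_of_mul_le_mul_left ?_ hfac
  rw [fRho, abs_neg]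
  have hcs : U * ((z - 2) * z + Z2 (Real.log s)) / s ^ 2 / s ^ 2 * s ^ 2 =
      U / s ^ 2 * ((z - 2) * z + Z2 (Real.log s)) := by
    field_simp
  rw [hcs] at hlim
  have e1 : U * z / s ^ 2 = U / s ^ 2 * z := by ring
  have e2 : U * |z| ^ (1 - τ) / s ^ 2 = U / s ^ 2 * |z| ^ (1 - τ) := by ring
  rw [e1, e2] at hlim
  linarith

/-- Comparison in a punctured ball with a strict radial sub-solution `exp (Z (log |x|))`. -/
lemma IsSuperSolutionE.exp_le_of_strict_radial_subsolution {N : ℕ} {ρ lam τ θ q r₀ : ℝ}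
    {Ω : Set (EuclideanSpace ℝ (Fin N))} {u : EuclideanSpace ℝ (Fin N) → ℝ}
    {Z Z1 Z2 : ℝ → ℝ} (hΩ : IsOpen (Ω \ {0})) (hN : 0 < N)
    (hτ1 : τ < 1) (hq : 1 < q) (hu : IsSuperSolutionE N ρ lam τ θ q Ω u)
    (hball : Metric.closedBall 0 r₀ ⊆ Ω)
    (hZ : ∀ t, HasDerivAt Z (Z1 t) t) (hZ1 : ∀ t, HasDerivAt Z1 (Z2 t) t) (hZ2 : Continuous Z2)
    (hbd : ∀ x : EuclideanSpace ℝ (Fin N), ‖x‖ = r₀ → Z (Real.log ‖x‖) ≤ Real.log (u x))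
    (hnear : ∀ᶠ x in 𝓝[≠] (0 : EuclideanSpace ℝ (Fin N)), Z (Real.log ‖x‖) ≤ Real.log (u x))
    (hsub : ∀ r, 0 < r → r ≤ r₀ → r ^ (θ + 2) * Real.exp (Z (Real.log r)) ^ (q - 1) <
      fRho ρ lam τ (-Z1 (Real.log r)) + Z2 (Real.log r)) :
    ∀ x : EuclideanSpace ℝ (Fin N), x ≠ 0 → ‖x‖ ≤ r₀ → Z (Real.log ‖x‖) ≤ Real.log (u x) := by
  intro x hx0 hxr
  by_contra! hlt
  obtain ⟨r₁, hr₁, hnear⟩ := Metric.eventually_nhds_iff.1 (eventually_nhdsWithin_iff.1 hnear)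
  have hbig : ∀ y : EuclideanSpace ℝ (Fin N), y ≠ 0 → Real.log (u y) - Z (Real.log ‖y‖) < 0 →
      r₁ ≤ ‖y‖ := by
    intro y hy h
    by_contra! hy1
    have := hnear (by simpa using hy1) hy
    linarith
  set A : Set (EuclideanSpace ℝ (Fin N)) := Metric.closedBall 0 r₀ \ Metric.ball 0 (r₁ / 2) with hA
  have hAc : IsCompact A := (isCompact_closedBall _ _).diff Metric.isOpen_ball
  have hAΩ : A ⊆ Ω \ {0} := fun y hy => ⟨hball hy.1, fun h => hy.2 (by
    rw [Set.mem_singleton_iff.1 h]; exact Metric.mem_ball_self (by linarith))⟩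
  have hZC : Continuous Z := continuous_iff_continuousAt.2 fun t => (hZ t).continuousAt
  have hF : ContinuousOn (fun y => Real.log (u y) - Z (Real.log ‖y‖)) (Ω \ {0}) :=
    (hu.1.1.continuousOn.log fun y hy => (hu.1.2 y hy).ne').sub
      (hZC.comp_continuousOn (continuousOn_id.norm.log fun y hy => norm_ne_zero_iff.2 hy.2))
  have hxA : x ∈ A := by
    have := hbig x hx0 (by linarith)
    refine ⟨by simpa using hxr, ?_⟩
    simp only [Metric.mem_ball, dist_zero_right, not_lt]
    linarith
  obtain ⟨x₀, hx₀A, hmin⟩ := hAc.exists_isMinOn ⟨x, hxA⟩ (hF.mono hAΩ)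
  have hx₀ := hAΩ hx₀A
  have hx₀ne : x₀ ≠ 0 := hx₀.2
  set μ := Real.log (u x₀) - Z (Real.log ‖x₀‖) with hμ
  have hμneg : μ < 0 := (hmin hxA).trans_lt (by linarith)
  have hle₀ : ‖x₀‖ ≤ r₀ := by simpa using hx₀A.1
  have hlt₀ : ‖x₀‖ < r₀ := lt_of_le_of_ne hle₀ fun h => by
    have := hbd x₀ h
    linarith
  have hge₀ := hbig x₀ hx₀ne hμneg
  have hnhds : A ∈ 𝓝 x₀ := by
    have h1 : {y : EuclideanSpace ℝ (Fin N) | ‖y‖ < r₀} ∈ 𝓝 x₀ :=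
      (isOpen_lt continuous_norm continuous_const).mem_nhds hlt₀
    have h2 : {y : EuclideanSpace ℝ (Fin N) | r₁ / 2 < ‖y‖} ∈ 𝓝 x₀ :=
      (isOpen_lt continuous_const continuous_norm).mem_nhds
        (by simp only [Set.mem_ofPred_eq]; linarith)
    filter_upwards [h1, h2] with y hy1 hy2
    refine ⟨by simpa using hy1.le, ?_⟩
    simpa using hy2.le
  have hupos : 0 < u x₀ := hu.1.2 x₀ hx₀
  have htouch := hu.radial_inequality_of_touching (Z := fun t => Z t + μ) hΩ hN hτ1 hx₀
    (fun t => (hZ t).add_const μ) hZ1 hZ2 (by rw [hμ, add_sub_cancel, Real.exp_log hupos]) (by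
      filter_upwards [hnhds] with y hy
      rw [← Real.le_log_iff_exp_le (hu.1.2 y (hAΩ hy))]
      have h : μ ≤ Real.log (u y) - Z (Real.log ‖y‖) := hmin hy
      linarith)
  have hstrict := hsub ‖x₀‖ (norm_pos_iff.2 hx₀ne) hle₀
  have hule : u x₀ ≤ Real.exp (Z (Real.log ‖x₀‖)) := by
    rw [← Real.log_le_iff_le_exp hupos]
    linarith
  have hpow : u x₀ ^ (q - 1) ≤ Real.exp (Z (Real.log ‖x₀‖)) ^ (q - 1) :=
    Real.rpow_le_rpow hupos.le hule (by linarith)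
  have := mul_le_mul_of_nonneg_left hpow (Real.rpow_nonneg (norm_nonneg x₀) (θ + 2))
  linarith

lemma continuous_fRho {ρ lam τ : ℝ} (hτ1 : τ < 1) : Continuous (fRho ρ lam τ) := by
  unfold fRho
  exact (by fun_prop : Continuous fun t : ℝ => t * (t + 2 * ρ)).add
    (continuous_const.mul (continuous_abs.rpow_const fun _ => Or.inr (by linarith)))

/-- The lower bound `c |x|^{-β} exp (-K (|x|/r₀)^δ)`, in logarithmic form. -/
lemma IsSuperSolutionE.exists_log_lower_bound {N : ℕ} {ρ lam τ θ q β c : ℝ}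
    {Ω : Set (EuclideanSpace ℝ (Fin N))} {u : EuclideanSpace ℝ (Fin N) → ℝ}
    (hΩ : IsOpen Ω) (h0 : (0 : EuclideanSpace ℝ (Fin N)) ∈ Ω) (hN : 0 < N)
    (hτ1 : τ < 1) (hq : 1 < q) (hβ : θ + 2 = β * (q - 1)) (hc : 0 < c)
    (hcf : c ^ (q - 1) < fRho ρ lam τ β) (hu : IsSuperSolutionE N ρ lam τ θ q Ω u)
    (hgrow : ∀ η : ℝ, 0 < η →
      Tendsto (fun x : EuclideanSpace ℝ (Fin N) => ‖x‖ ^ (β - η) * u x) (𝓝[≠] 0) atTop) :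
    ∃ r₀ K δ t₀ : ℝ, 0 < r₀ ∧ 0 < δ ∧ Metric.closedBall 0 r₀ ⊆ Ω ∧
      ∀ x : EuclideanSpace ℝ (Fin N), x ≠ 0 → ‖x‖ ≤ r₀ →
        Real.log c - β * Real.log ‖x‖ - K * Real.exp (δ * (Real.log ‖x‖ - t₀)) ≤
          Real.log (u x) := by
  have hΩ' : IsOpen (Ω \ {0}) := hΩ.sdiff isClosed_singleton
  set σ := (fRho ρ lam τ β - c ^ (q - 1)) / 2 with hσ
  have hσpos : 0 < σ := by rw [hσ]; linarith
  obtain ⟨δ₀, hδ₀, hfδ⟩ := Metric.eventually_nhds_iff.1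
    ((continuous_fRho (ρ := ρ) (lam := lam) hτ1).continuousAt.eventually
      (lt_mem_nhds (show c ^ (q - 1) + σ < fRho ρ lam τ β by rw [hσ]; linarith)))
  obtain ⟨r₀, hr₀, hball⟩ := Metric.nhds_basis_closedBall.mem_iff.1 (hΩ.mem_nhds h0)
  set t₀ := Real.log r₀ with ht₀
  obtain ⟨B, hB⟩ : ∃ B, ∀ x : EuclideanSpace ℝ (Fin N), ‖x‖ = r₀ → B ≤ Real.log (u x) := by
    have hsub : Metric.sphere (0 : EuclideanSpace ℝ (Fin N)) r₀ ⊆ Ω \ {0} := fun x hx =>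
      ⟨hball (Metric.sphere_subset_closedBall hx), Metric.ne_of_mem_sphere hx hr₀.ne'⟩
    obtain ⟨B, hB⟩ := (isCompact_sphere (0 : EuclideanSpace ℝ (Fin N)) r₀).bddBelow_image
      ((hu.1.1.continuousOn.log fun y hy => (hu.1.2 y hy).ne').mono hsub)
    exact ⟨B, fun x hx => hB ⟨x, by simpa using hx, rfl⟩⟩
  set K := max 0 (Real.log c - β * t₀ - B) with hK
  have hK0 : 0 ≤ K := le_max_left _ _
  have hKB : Real.log c - β * t₀ - K ≤ B := by
    have := le_max_right 0 (Real.log c - β * t₀ - B)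
    linarith
  obtain ⟨δ, hδ, hδ1, hKδ₀, hKσ⟩ : ∃ δ : ℝ, 0 < δ ∧ δ ≤ 1 ∧ K * δ < δ₀ / 2 ∧ K * δ < σ := by
    have ht : Tendsto (fun δ : ℝ => K * δ) (𝓝[>] 0) (𝓝 0) := by
      have : Tendsto (fun δ : ℝ => K * δ) (𝓝 0) (𝓝 (K * 0)) :=
        (continuous_const.mul continuous_id).tendsto 0
      rw [mul_zero] at this
      exact this.mono_left nhdsWithin_le_nhds
    have h1 : ∀ᶠ δ : ℝ in 𝓝[>] 0, δ ≤ 1 :=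
      nhdsWithin_le_nhds (eventually_le_nhds one_pos)
    obtain ⟨δ, ⟨⟨h1, h2⟩, h3⟩, h4⟩ := (((h1.and (ht.eventually (gt_mem_nhds (half_pos hδ₀)))).and
      (ht.eventually (gt_mem_nhds hσpos))).and self_mem_nhdsWithin).exists
    exact ⟨δ, h4, h1, h2, h3⟩
  refine ⟨r₀, K, δ, t₀, hr₀, hδ, hball, ?_⟩
  have hη : ∀ η : ℝ, 0 < η → η < δ₀ / 2 → ∀ x : EuclideanSpace ℝ (Fin N), x ≠ 0 → ‖x‖ ≤ r₀ →
      Real.log c - β * Real.log ‖x‖ + η * (Real.log ‖x‖ - t₀)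
        - K * Real.exp (δ * (Real.log ‖x‖ - t₀)) ≤ Real.log (u x) := by
    intro η hη hηδ
    have hexpd : ∀ t, HasDerivAt (fun t => Real.exp (δ * (t - t₀)))
        (δ * Real.exp (δ * (t - t₀))) t := fun t =>
      ((((hasDerivAt_id t).sub_const t₀).const_mul δ).exp).congr_deriv (by simp [mul_comm])
    refine hu.exp_le_of_strict_radial_subsolution
      (Z := fun t => Real.log c - β * t + η * (t - t₀) - K * Real.exp (δ * (t - t₀)))
      (Z1 := fun t => -β + η - K * (δ * Real.exp (δ * (t - t₀))))
      (Z2 := fun t => -(K * (δ * (δ * Real.exp (δ * (t - t₀)))))) hΩ' hN hτ1 hq hball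
      ?_ ?_ (by fun_prop) ?_ ?_ ?_
    · intro t
      exact (((((hasDerivAt_id t).const_mul β).const_sub (Real.log c)).add
        (((hasDerivAt_id t).sub_const t₀).const_mul η)).sub ((hexpd t).const_mul K)).congr_deriv
          (by ring)
    · intro t
      exact ((((hexpd t).const_mul δ).const_mul K).const_sub (-β + η)).congr_deriv (by ring)
    · intro x hx
      refine le_trans ?_ (hB x hx)
      simpa [hx, ← ht₀] using hKB
    · filter_upwards [(hgrow η hη).eventually_ge_atTop (c * Real.exp (-(η * t₀))),
        nhdsWithin_le_nhds (hΩ.mem_nhds h0), self_mem_nhdsWithin] with x hx hxΩ hxne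
      have hxpos : 0 < ‖x‖ := norm_pos_iff.2 hxne
      have hupos : 0 < u x := hu.1.2 x ⟨hxΩ, hxne⟩
      have h := Real.log_le_log (by positivity) hx
      rw [Real.log_mul hc.ne' (Real.exp_pos _).ne', Real.log_exp,
        Real.log_mul (Real.rpow_pos_of_pos hxpos _).ne' hupos.ne', Real.log_rpow hxpos] at h
      have : 0 ≤ K * Real.exp (δ * (Real.log ‖x‖ - t₀)) := by positivity
      linarith
    · intro r hr hrr
      have ht : Real.log r - t₀ ≤ 0 := sub_nonpos.2 (Real.log_le_log hr hrr)
      set e := Real.exp (δ * (Real.log r - t₀)) with he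
      have he0 : 0 < e := Real.exp_pos _
      have he1 : e ≤ 1 := Real.exp_le_one_iff.2 (mul_nonpos_of_nonneg_of_nonpos hδ.le ht)
      have hKδe : K * (δ * e) ≤ K * δ :=
        mul_le_mul_of_nonneg_left (mul_le_of_le_one_right hδ.le he1) hK0
      have hKδe0 : 0 ≤ K * (δ * e) := by positivity
      have hKδδe : K * (δ * (δ * e)) ≤ K * (δ * e) :=
        mul_le_mul_of_nonneg_left (mul_le_of_le_one_left (by positivity) hδ1) hK0
      have hleft : r ^ (θ + 2) * Real.exp (Real.log c - β * Real.log r + η * (Real.log r - t₀)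
          - K * e) ^ (q - 1) ≤ c ^ (q - 1) := by
        rw [Real.rpow_def_of_pos hr, ← Real.exp_mul, ← Real.exp_add, Real.rpow_def_of_pos hc,
          Real.exp_le_exp, hβ]
        have h1 : η * (Real.log r - t₀) - K * e ≤ 0 := by
          have := mul_nonpos_of_nonneg_of_nonpos hη.le ht
          have : 0 ≤ K * e := by positivity
          linarith
        have h2 := mul_nonpos_of_nonpos_of_nonneg h1 (by linarith : 0 ≤ q - 1)
        linarith
      have hf : c ^ (q - 1) + σ < fRho ρ lam τ (-(-β + η - K * (δ * e))) := by
        apply hfδ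
        rw [Real.dist_eq, abs_lt]
        constructor <;> linarith
      linarith
  intro x hx hxr
  have hlim : Tendsto (fun η : ℝ => Real.log c - β * Real.log ‖x‖ + η * (Real.log ‖x‖ - t₀)
      - K * Real.exp (δ * (Real.log ‖x‖ - t₀))) (𝓝[>] 0)
      (𝓝 (Real.log c - β * Real.log ‖x‖ + 0 * (Real.log ‖x‖ - t₀)
      - K * Real.exp (δ * (Real.log ‖x‖ - t₀)))) :=
    (Continuous.tendsto (by fun_prop) 0).mono_left nhdsWithin_le_nhds
  rw [zero_mul, add_zero] at hlim
  refine le_of_tendsto hlim ?_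
  filter_upwards [self_mem_nhdsWithin, nhdsWithin_le_nhds (gt_mem_nhds (half_pos hδ₀))]
    with η h1 h2
  exact hη η h1 h2 x hx hxr

/-- If `f_ρ(β) > 0` and `u` is a positive super-solution of (E) in `Ω \ {0}`
such that `|x|^{β-η} u(x) → ∞` as `|x| → 0` for every `η > 0`, then
`liminf_{|x|→0} |x|^β u(x) ≥ Λ`, i.e. for every `ε > 0` eventually `Λ - ε ≤ |x|^β u(x)`. -/
theorem stmt6_liminf_ge_Lambda
    (N : ℕ) (hN : 2 ≤ N) (ρ lam τ θ q : ℝ)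
    (hτ0 : 0 ≤ τ) (hτ1 : τ < 1) (hq : 1 < q)
    (Ω : Set (EuclideanSpace ℝ (Fin N))) (hΩ : IsOpen Ω) (h0 : (0 : EuclideanSpace ℝ (Fin N)) ∈ Ω)
    (hf : 0 < fRho ρ lam τ ((θ + 2) / (q - 1)))
    (u : EuclideanSpace ℝ (Fin N) → ℝ)
    (hu : IsSuperSolutionE N ρ lam τ θ q Ω u)
    (hgrow : ∀ η : ℝ, 0 < η →
      Filter.Tendsto (fun x : EuclideanSpace ℝ (Fin N) => ‖x‖ ^ ((θ + 2) / (q - 1) - η) * u x)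
        (𝓝[≠] (0 : EuclideanSpace ℝ (Fin N))) atTop) :
    ∀ ε : ℝ, 0 < ε → ∀ᶠ x in 𝓝[≠] (0 : EuclideanSpace ℝ (Fin N)),
      (fRho ρ lam τ ((θ + 2) / (q - 1))) ^ (1 / (q - 1)) - ε ≤
        ‖x‖ ^ ((θ + 2) / (q - 1)) * u x := by
  intro ε hε
  set β := (θ + 2) / (q - 1) with hβdef
  have hq1 : 0 < q - 1 := by linarith
  have hβ : θ + 2 = β * (q - 1) := by
    rw [hβdef]
    field_simp
  set L := (fRho ρ lam τ β) ^ (1 / (q - 1)) with hL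
  have hLpos : 0 < L := Real.rpow_pos_of_pos hf _
  obtain ⟨c, hcmax, hcL⟩ := exists_between (max_lt hLpos (by linarith : L - ε < L))
  have hc : 0 < c := (le_max_left _ _).trans_lt hcmax
  have hcε : L - ε < c := (le_max_right _ _).trans_lt hcmax
  have hcf : c ^ (q - 1) < fRho ρ lam τ β := by
    have h := Real.rpow_lt_rpow hc.le hcL hq1
    rwa [hL, ← Real.rpow_mul hf.le, one_div_mul_cancel hq1.ne', Real.rpow_one] at h
  obtain ⟨r₀, K, δ, t₀, hr₀, hδ, hball, hlow⟩ :=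
    hu.exists_log_lower_bound hΩ h0 (by lia) hτ1 hq hβ hc hcf hgrow
  have hlog : Tendsto (fun x : EuclideanSpace ℝ (Fin N) => Real.log ‖x‖) (𝓝[≠] 0) atBot :=
    Real.tendsto_log_nhdsGT_zero.comp tendsto_norm_nhdsNE_zero
  have hprof : Tendsto (fun t : ℝ => c * Real.exp (-(K * Real.exp (δ * (t - t₀))))) atBot
      (𝓝 (c * Real.exp (-(K * 0)))) := by
    have h : Tendsto (fun t : ℝ => Real.exp (δ * (t - t₀))) atBot (𝓝 0) :=
      Real.tendsto_exp_atBot.comp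
        ((tendsto_atBot_add_const_right atBot (-t₀) tendsto_id).const_mul_atBot hδ)
    exact ((Real.continuous_exp.tendsto _).comp (h.const_mul K).neg).const_mul c
  rw [mul_zero, neg_zero, Real.exp_zero, mul_one] at hprof
  filter_upwards [(hprof.comp hlog).eventually (lt_mem_nhds hcε), self_mem_nhdsWithin,
    nhdsWithin_le_nhds (Metric.closedBall_mem_nhds 0 hr₀)] with x hx hxne hxr
  have hxpos : 0 < ‖x‖ := norm_pos_iff.2 hxne
  have hupos : 0 < u x := hu.1.2 x ⟨hball hxr, hxne⟩
  refine hx.le.trans ?_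
  have h := hlow x hxne (by simpa using hxr)
  have hprod : 0 < ‖x‖ ^ β * u x := mul_pos (Real.rpow_pos_of_pos hxpos _) hupos
  simp only [Function.comp_apply]
  rw [← Real.log_le_log_iff (by positivity) hprod,
    Real.log_mul hc.ne' (Real.exp_pos _).ne', Real.log_exp,
    Real.log_mul (Real.rpow_pos_of_pos hxpos _).ne' hupos.ne', Real.log_rpow hxpos]
  linarith

end
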